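/- Let n ≥ 3 be an integer, ρ ∈ (-1,1), and let R be a real random variable with law f_{n,ρ}. Then E[R] = ρ (1-ρ²)^{(n-1)/2} · Σ_{q=0}^∞ (Γ(q + (n-1)/2) / (Γ(q+1) Γ((n-1)/2))) · κ(q + n/2) · ρ^{2q}. -/

import Mathlib

open MeasureTheory Real

/-- Fisher's density of the sample correlation coefficient of a size-`n` sample from a
bivariate normal distribution with population correlation `ρ`. -/
noncomputable def fisherDensity (n : ℕ) (ρ : ℝ) (r : ℝ) : ℝ :=
  if |r| < 1 then
    (2 ^ ((n : ℝ) - 3) * (1 - ρ ^ 2) ^ (((n : ℝ) - 1) / 2) *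
        (1 - r ^ 2) ^ (((n : ℝ) - 4) / 2) / (π * Gamma ((n : ℝ) - 2))) *
      ∑' k : ℕ, (Gamma (((n : ℝ) - 1 + (k : ℝ)) / 2)) ^ 2 * (2 * r * ρ) ^ k / (Nat.factorial k : ℝ)
  else 0

/-- `κ(z) = Γ(z)² / (Γ(z+1/2) Γ(z-1/2))`. -/
noncomputable def kappa (z : ℝ) : ℝ :=
  Gamma z ^ 2 / (Gamma (z + 1 / 2) * Gamma (z - 1 / 2))


lemma aux_beta {a b : ℝ} (ha : 0 < a) (hb : 0 < b) :
    ∫ x in Set.Ioo (0:ℝ) 1, x ^ (a - 1) * (1 - x) ^ (b - 1)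
      = Gamma a * Gamma b / Gamma (a + b) := by
  have h1 := ProbabilityTheory.beta_eq_betaIntegralReal a b ha hb
  rw [ProbabilityTheory.beta] at h1
  rw [h1, Complex.betaIntegral, intervalIntegral.integral_of_le zero_le_one,
    ← integral_Ioc_eq_integral_Ioo]
  have : ∀ x ∈ Set.Ioc (0:ℝ) 1, (x:ℂ) ^ ((a:ℂ) - 1) * (1 - (x:ℂ)) ^ ((b:ℂ) - 1)
      = ((x ^ (a - 1) * (1 - x) ^ (b - 1) : ℝ) : ℂ) := by
    intro x hx
    push_cast
    rw [Complex.ofReal_cpow hx.1.le, Complex.ofReal_cpow (by linarith [hx.2])]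
    push_cast
    rfl
  rw [setIntegral_congr_fun measurableSet_Ioc this, integral_complex_ofReal, Complex.ofReal_re]

lemma aux_beta_int {a b : ℝ} (ha : 0 < a) (hb : 0 < b) :
    IntegrableOn (fun x : ℝ => x ^ (a - 1) * (1 - x) ^ (b - 1)) (Set.Ioo (0:ℝ) 1) := by
  apply Integrable.of_integral_ne_zero
  rw [aux_beta ha hb]
  have := Gamma_pos_of_pos ha
  have := Gamma_pos_of_pos hb
  have := Gamma_pos_of_pos (add_pos ha hb)
  positivity

lemma aux_J {a b : ℝ} (ha : 0 < a) (hb : 0 < b) :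
    ∫ x : ℝ, (if |x| < 1 then |x| ^ (2 * a - 1) * (1 - x ^ 2) ^ (b - 1) else 0)
      = Gamma a * Gamma b / Gamma (a + b) := by
  have h1 := integral_comp_abs
    (f := fun x : ℝ => if x < 1 then x ^ (2 * a - 1) * (1 - x ^ 2) ^ (b - 1) else 0)
  simp only [sq_abs] at h1
  rw [h1, ← aux_beta ha hb]
  have h2 := integral_comp_rpow_Ioi
    (fun y : ℝ => if y < 1 then y ^ (a - 1) * (1 - y) ^ (b - 1) else 0) (p := 2) two_ne_zero
  have h3 : ∫ y in Set.Ioi (0:ℝ), (if y < 1 then y ^ (a - 1) * (1 - y) ^ (b - 1) else 0)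
      = ∫ x in Set.Ioo (0:ℝ) 1, x ^ (a - 1) * (1 - x) ^ (b - 1) := by
    rw [← Set.Ioi_inter_Iio, ← setIntegral_indicator measurableSet_Iio]
    rfl
  rw [← h3, ← h2, ← integral_const_mul]
  apply setIntegral_congr_fun measurableSet_Ioi
  intro x hx
  have hx : 0 < x := hx
  have hiff : x ^ 2 < 1 ↔ x < 1 := by
    constructor <;> intro h <;> nlinarith
  simp only [Real.rpow_two, hiff, smul_eq_mul]
  split_ifs
  · have : x ^ (2 * a - 1) = x ^ ((2:ℝ) - 1) * (x ^ 2) ^ (a - 1) := by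
      rw [← Real.rpow_two, ← Real.rpow_mul hx.le, ← Real.rpow_add hx]
      congr 1; ring
    rw [this, abs_of_pos (by norm_num : (0:ℝ) < 2)]
    ring
  · simp

lemma aux_W_int {b : ℝ} (hb : 0 < b) :
    Integrable (fun x : ℝ => if |x| < 1 then (1 - x ^ 2) ^ (b - 1) else 0) := by
  apply Integrable.of_integral_ne_zero
  have := aux_J (a := 1/2) (by norm_num) hb
  norm_num at this
  rw [this]
  have := Gamma_pos_of_pos hb
  have := Gamma_pos_of_pos (show 0 < 1/2 + b by linarith)
  positivity

/-- Summand coefficient. -/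
noncomputable def auxCoef (n k : ℕ) : ℝ :=
  (Gamma (((n : ℝ) - 1 + (k : ℝ)) / 2)) ^ 2 / (Nat.factorial k : ℝ)

lemma auxCoef_nonneg (n k : ℕ) : 0 ≤ auxCoef n k := by unfold auxCoef; positivity

/-- Beta kernel. -/
noncomputable def auxK (p : ℕ) (u : ℝ) : ℝ :=
  u ^ (((p:ℝ) + 1) / 2 - 1) * (1 - u) ^ (((p:ℝ) + 1) / 2 - 1)

lemma auxK_int (p : ℕ) : IntegrableOn (auxK p) (Set.Ioo (0:ℝ) 1) := 
  aux_beta_int (by positivity) (by positivity)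

lemma auxK_nonneg (p : ℕ) {u : ℝ} (hu : u ∈ Set.Ioo (0:ℝ) 1) : 0 ≤ auxK p u := by
  have := hu.1
  have : 0 < 1 - u := by linarith [hu.2]
  unfold auxK; positivity

lemma aux_kernel (p k : ℕ) {u : ℝ} (hu : u ∈ Set.Ioo (0:ℝ) 1) :
    u ^ (((p:ℝ) + 1 + k) / 2 - 1) * (1 - u) ^ (((p:ℝ) + 1 + k) / 2 - 1)
      = auxK p u * √(u * (1 - u)) ^ k := by
  have h1 := hu.1
  have h2 : 0 < 1 - u := by linarith [hu.2]
  have : √(u * (1 - u)) ^ k = u ^ ((k:ℝ)/2) * (1 - u) ^ ((k:ℝ)/2) := by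
    rw [← Real.mul_rpow h1.le h2.le, Real.sqrt_eq_rpow, ← Real.rpow_natCast,
      ← Real.rpow_mul (by positivity)]
    congr 1; ring
  rw [this, auxK, mul_mul_mul_comm, ← Real.rpow_add h1, ← Real.rpow_add h2]
  congr 2 <;> ring

lemma auxCoef_eq (p k : ℕ) :
    auxCoef (p + 2) k = (Nat.factorial p : ℝ) * ((k + p).choose p) *
      ∫ u in Set.Ioo (0:ℝ) 1, auxK p u * √(u * (1 - u)) ^ k := by
  have h := aux_beta (a := ((p:ℝ) + 1 + k) / 2) (b := ((p:ℝ) + 1 + k) / 2)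
    (by positivity) (by positivity)
  rw [setIntegral_congr_fun measurableSet_Ioo (fun u hu => aux_kernel p k hu)] at h
  rw [h, auxCoef, show ((p:ℝ) + 1 + k) / 2 + ((p:ℝ) + 1 + k) / 2 = ((k + p : ℕ) : ℝ) + 1 by
    push_cast; ring, Real.Gamma_nat_eq_factorial, ← Nat.add_choose_mul_factorial_mul_factorial k p]
  rw [show (((p + 2 : ℕ) : ℝ) - 1 + k) / 2 = ((p:ℝ) + 1 + k) / 2 by push_cast; ring]
  have : ((k + p).choose p : ℝ) ≠ 0 := by
    exact_mod_cast (Nat.choose_pos (Nat.le_add_left p k)).ne'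
  have := Nat.factorial_ne_zero k
  have := Nat.factorial_ne_zero p
  push_cast
  field_simp

lemma aux_sqrt_le {u : ℝ} : √(u * (1 - u)) ≤ 1 / 2 := by
  rw [Real.sqrt_le_left (by norm_num)]
  nlinarith [sq_nonneg (2 * u - 1)]

lemma auxK_pow_int (p k : ℕ) :
    IntegrableOn (fun u => auxK p u * √(u * (1 - u)) ^ k) (Set.Ioo (0:ℝ) 1) := by
  have := aux_beta_int (a := ((p:ℝ) + 1 + k) / 2) (b := ((p:ℝ) + 1 + k) / 2)
    (by positivity) (by positivity)
  exact this.congr_fun (fun u hu => aux_kernel p k hu) measurableSet_Ioo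

lemma auxCoef_le (p k : ℕ) :
    auxCoef (p + 2) k ≤ (Nat.factorial p : ℝ) * ((k + p).choose p) *
      ((∫ u in Set.Ioo (0:ℝ) 1, auxK p u) * (1 / 2) ^ k) := by
  rw [auxCoef_eq, ← integral_mul_const]
  apply mul_le_mul_of_nonneg_left _ (by positivity)
  apply setIntegral_mono_on (auxK_pow_int p k) ((auxK_int p).mul_const _) measurableSet_Ioo
  intro u hu
  apply mul_le_mul_of_nonneg_left _ (auxK_nonneg p hu)
  exact pow_le_pow_left₀ (Real.sqrt_nonneg _) aux_sqrt_le k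

lemma auxCoef_summable (p : ℕ) {x : ℝ} (hx : |x| < 2) :
    Summable (fun k => auxCoef (p + 2) k * |x| ^ k) := by
  have h := (summable_choose_mul_geometric_of_norm_lt_one p (r := |x| / 2) (by
    rw [Real.norm_eq_abs, abs_of_nonneg (by positivity)]; linarith)).mul_left
    ((Nat.factorial p : ℝ) * ∫ u in Set.Ioo (0:ℝ) 1, auxK p u)
  refine Summable.of_nonneg_of_le (fun k => mul_nonneg (auxCoef_nonneg _ _) (by positivity))
    (fun k => ?_) h
  refine (mul_le_mul_of_nonneg_right (auxCoef_le p k) (by positivity)).trans (le_of_eq ?_)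
  rw [div_pow, div_pow]
  ring

lemma auxCoef_summable' (p : ℕ) {x : ℝ} (hx : |x| < 2) :
    Summable (fun k => auxCoef (p + 2) k * x ^ k) := by
  apply Summable.of_norm
  convert! auxCoef_summable p hx using 2 with k
  rw [norm_mul, norm_pow, Real.norm_eq_abs, Real.norm_eq_abs, abs_of_nonneg (auxCoef_nonneg _ _)]

lemma auxCoef_tsum_nonneg (p : ℕ) {x : ℝ} (hx : |x| < 2) :
    0 ≤ ∑' k, auxCoef (p + 2) k * x ^ k := by
  have hs := hasSum_integral_of_summable_integral_norm
    (μ := volume.restrict (Set.Ioo (0:ℝ) 1))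
    (F := fun k u => (Nat.factorial p : ℝ) * ((k + p).choose p) * x ^ k *
      (auxK p u * √(u * (1 - u)) ^ k))
    (fun k => (auxK_pow_int p k).const_mul _) (by
      convert! auxCoef_summable p hx using 2 with k
      rw [auxCoef_eq, mul_right_comm _ _ (|x| ^ k), ← integral_const_mul]
      apply setIntegral_congr_fun measurableSet_Ioo
      intro u hu
      have := auxK_nonneg p hu
      simp only [norm_mul, norm_pow, Real.norm_eq_abs, Nat.abs_cast, abs_of_nonneg this,
        abs_of_nonneg (Real.sqrt_nonneg _)])

  have : ∀ k, ∫ u in Set.Ioo (0:ℝ) 1, (Nat.factorial p : ℝ) * ((k + p).choose p) * x ^ k *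
      (auxK p u * √(u * (1 - u)) ^ k) = auxCoef (p + 2) k * x ^ k := by
    intro k
    rw [auxCoef_eq, integral_const_mul]; ring
  simp only [this] at hs
  rw [hs.tsum_eq]
  apply setIntegral_nonneg measurableSet_Ioo
  intro u hu
  have hy : |x * √(u * (1 - u))| < 1 := by
    rw [abs_mul, abs_of_nonneg (Real.sqrt_nonneg _)]
    have := aux_sqrt_le (u := u)
    have := Real.sqrt_nonneg (u * (1 - u))
    nlinarith [abs_nonneg x]
  have h := (hasSum_choose_mul_geometric_of_norm_lt_one p
    (r := x * √(u * (1 - u))) hy).mul_left ((Nat.factorial p : ℝ) * auxK p u)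
  have h' : ∀ k : ℕ, (Nat.factorial p : ℝ) * ((k + p).choose p) * x ^ k *
      (auxK p u * √(u * (1 - u)) ^ k) = (Nat.factorial p : ℝ) * auxK p u *
      (((k + p).choose p) * (x * √(u * (1 - u))) ^ k) := by
    intro k; rw [mul_pow]; ring
  simp only [h']
  rw [h.tsum_eq]
  have := (abs_lt.1 hy).2
  have h4 : 0 < 1 - x * √(u * (1 - u)) := by linarith
  have := auxK_nonneg p hu
  positivity

/-- Weight `(1 - r^2)^((n-4)/2)` on `(-1,1)`. -/
noncomputable def auxW (n : ℕ) (r : ℝ) : ℝ :=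
  if |r| < 1 then (1 - r ^ 2) ^ (((n : ℝ) - 4) / 2) else 0

lemma auxW_nonneg (n : ℕ) (r : ℝ) : 0 ≤ auxW n r := by
  unfold auxW
  split_ifs with h
  · have : r ^ 2 < 1 := (sq_lt_one_iff_abs_lt_one r).2 h
    exact Real.rpow_nonneg (by linarith) _
  · exact le_rfl

lemma auxW_int (n : ℕ) (hn : 3 ≤ n) : Integrable (auxW n) := by
  have hn' : (3:ℝ) ≤ n := by exact_mod_cast hn
  have := aux_W_int (b := ((n:ℝ) - 2) / 2) (by linarith)
  rw [show ((n:ℝ) - 2) / 2 - 1 = ((n:ℝ) - 4) / 2 by ring] at this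
  exact this

lemma auxW_meas (n : ℕ) : Measurable (auxW n) := by
  unfold auxW
  apply Measurable.ite
  · exact measurableSet_lt (by fun_prop) measurable_const
  · fun_prop
  · fun_prop

/-- Normalising constant. -/
noncomputable def auxC (n : ℕ) (ρ : ℝ) : ℝ :=
  2 ^ ((n : ℝ) - 3) * (1 - ρ ^ 2) ^ (((n : ℝ) - 1) / 2) / (π * Gamma ((n : ℝ) - 2))

/-- Terms of the density. -/
noncomputable def auxT (n : ℕ) (ρ : ℝ) (k : ℕ) (r : ℝ) : ℝ :=
  auxC n ρ * auxW n r * (auxCoef n k * (2 * r * ρ) ^ k)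

lemma auxC_nonneg (n : ℕ) (hn : 3 ≤ n) (ρ : ℝ) (hρ : ρ ∈ Set.Ioo (-1 : ℝ) 1) :
    0 ≤ auxC n ρ := by
  have hn' : (3:ℝ) ≤ n := by exact_mod_cast hn
  have h1 : 0 < 1 - ρ ^ 2 := by nlinarith [hρ.1, hρ.2]
  have := Gamma_pos_of_pos (show 0 < (n:ℝ) - 2 by linarith)
  unfold auxC; positivity

lemma fisher_eq (n : ℕ) (ρ r : ℝ) :
    fisherDensity n ρ r = auxC n ρ * auxW n r * ∑' k, auxCoef n k * (2 * r * ρ) ^ k := by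
  unfold fisherDensity auxC auxW auxCoef
  split_ifs with h
  · congr 1
    · ring
    · congr 1; ext k; ring
  · simp

lemma aux_abs_lt {ρ r : ℝ} (hρ : ρ ∈ Set.Ioo (-1 : ℝ) 1) (hr : |r| < 1) :
    |2 * r * ρ| < 2 := by
  rw [mul_assoc, abs_mul, abs_mul, abs_two]
  have := abs_lt.2 hρ
  nlinarith [abs_nonneg r, abs_nonneg ρ]

lemma auxT_hasSum (n : ℕ) (hn : 3 ≤ n) (ρ : ℝ) (hρ : ρ ∈ Set.Ioo (-1 : ℝ) 1) (r : ℝ) :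
    HasSum (fun k => auxT n ρ k r) (fisherDensity n ρ r) := by
  rw [fisher_eq]
  unfold auxT
  by_cases hr : |r| < 1
  · apply HasSum.mul_left
    obtain ⟨p, rfl⟩ := Nat.exists_eq_add_of_le' (show 2 ≤ n by omega)
    exact (auxCoef_summable' p (aux_abs_lt hρ hr)).hasSum
  · simp [auxW, hr, hasSum_zero]

lemma fisher_nonneg (n : ℕ) (hn : 3 ≤ n) (ρ : ℝ) (hρ : ρ ∈ Set.Ioo (-1 : ℝ) 1) (r : ℝ) :
    0 ≤ fisherDensity n ρ r := by
  rw [fisher_eq]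
  by_cases hr : |r| < 1
  · apply mul_nonneg (mul_nonneg (auxC_nonneg n hn ρ hρ) (auxW_nonneg n r))
    obtain ⟨p, rfl⟩ := Nat.exists_eq_add_of_le' (show 2 ≤ n by omega)
    exact auxCoef_tsum_nonneg p (aux_abs_lt hρ hr)
  · simp [auxW, hr]

lemma auxT_meas (n : ℕ) (ρ : ℝ) (k : ℕ) : Measurable (auxT n ρ k) := by
  have := auxW_meas n
  unfold auxT
  fun_prop

lemma fisher_meas (n : ℕ) (hn : 3 ≤ n) (ρ : ℝ) (hρ : ρ ∈ Set.Ioo (-1 : ℝ) 1) :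
    Measurable (fisherDensity n ρ) := by
  refine measurable_of_tendsto_metrizable
    (f := fun N r => ∑ k ∈ Finset.range N, auxT n ρ k r) ?_ ?_
  · intro N
    exact Finset.measurable_fun_sum _ (fun k _ => auxT_meas n ρ k)
  · rw [tendsto_pi_nhds]
    intro r
    exact (auxT_hasSum n hn ρ hρ r).tendsto_sum_nat

lemma auxT_bound (n : ℕ) (hn : 3 ≤ n) (ρ : ℝ) (hρ : ρ ∈ Set.Ioo (-1 : ℝ) 1) (k : ℕ) (r : ℝ) :
    ‖auxT n ρ k r * r‖ ≤ (auxC n ρ * (auxCoef n k * |2 * ρ| ^ k)) * auxW n r := by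
  have hC := auxC_nonneg n hn ρ hρ
  have hW := auxW_nonneg n r
  have hc := auxCoef_nonneg n k
  by_cases hr : |r| < 1
  · have : ‖auxT n ρ k r * r‖ =
      (auxC n ρ * (auxCoef n k * |2 * ρ| ^ k)) * auxW n r * (|r| ^ (k + 1)) := by
      unfold auxT
      simp only [norm_mul, norm_pow, Real.norm_eq_abs, abs_mul, abs_of_nonneg hC,
        abs_of_nonneg hW, abs_of_nonneg hc]
      ring
    rw [this]
    apply mul_le_of_le_one_right (by positivity)
    exact pow_le_one₀ (abs_nonneg _) hr.le
  · simp [auxT, auxW, hr]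

lemma auxT_int (n : ℕ) (hn : 3 ≤ n) (ρ : ℝ) (hρ : ρ ∈ Set.Ioo (-1 : ℝ) 1) (k : ℕ) :
    Integrable (fun r => auxT n ρ k r * r) :=
  Integrable.mono' ((auxW_int n hn).const_mul _)
    ((auxT_meas n ρ k).mul measurable_id).aestronglyMeasurable
    (Filter.Eventually.of_forall (auxT_bound n hn ρ hρ k))

lemma auxT_integral_even (n : ℕ) (ρ : ℝ) (q : ℕ) :
    ∫ r, auxT n ρ (2 * q) r * r = 0 := by
  have h := integral_neg_eq_self (fun r => auxT n ρ (2 * q) r * r) volume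
  have h2 : ∀ r, auxT n ρ (2 * q) (-r) * (-r) = -(auxT n ρ (2 * q) r * r) := by
    intro r
    simp only [auxT, auxW, abs_neg, pow_mul]
    ring_nf
  simp only [h2, integral_neg] at h
  linarith

lemma auxT_integral_odd (n : ℕ) (hn : 3 ≤ n) (ρ : ℝ) (q : ℕ) :
    ∫ r, auxT n ρ (2 * q + 1) r * r = ρ * (1 - ρ ^ 2) ^ (((n : ℝ) - 1) / 2) *
      (Gamma ((q : ℝ) + ((n : ℝ) - 1) / 2) /
            (Gamma ((q : ℝ) + 1) * Gamma (((n : ℝ) - 1) / 2)) *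
          kappa ((q : ℝ) + (n : ℝ) / 2) * ρ ^ (2 * q)) := by
  have hn' : (3:ℝ) ≤ n := by exact_mod_cast hn
  have hJ := aux_J (a := (q:ℝ) + 3/2) (b := ((n:ℝ) - 2) / 2) (by positivity) (by linarith)
  have h1 : ∀ r, auxT n ρ (2 * q + 1) r * r =
      (auxC n ρ * (auxCoef n (2 * q + 1) * (2 * ρ) ^ (2 * q + 1))) *
      (if |r| < 1 then |r| ^ (2 * ((q:ℝ) + 3/2) - 1) * (1 - r ^ 2) ^ (((n:ℝ) - 2) / 2 - 1)
        else 0) := by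
    intro r
    unfold auxT auxW
    split_ifs
    · rw [show 2 * ((q:ℝ) + 3/2) - 1 = ((2 * (q + 1) : ℕ) : ℝ) by push_cast; ring,
        Real.rpow_natCast, pow_mul |r|, sq_abs, ← pow_mul,
        show ((n:ℝ) - 2) / 2 - 1 = ((n:ℝ) - 4) / 2 by ring]
      ring
    · simp
  simp only [h1]
  rw [integral_const_mul, hJ]
  unfold auxC auxCoef kappa
  have d1 := Real.Gamma_mul_Gamma_add_half (((n:ℝ) - 2) / 2)
  have d2 := Real.Gamma_mul_Gamma_add_half ((q:ℝ) + 1)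
  have f1 : ((2 * q + 1).factorial : ℝ) = Gamma (2 * ((q:ℝ) + 1)) := by
    rw [← Real.Gamma_nat_eq_factorial]; congr 1; push_cast; ring
  rw [f1]
  rw [show ((n:ℝ) - 2) / 2 + 1 / 2 = ((n:ℝ) - 1) / 2 by ring,
    show 2 * (((n:ℝ) - 2) / 2) = (n:ℝ) - 2 by ring] at d1
  rw [show (q:ℝ) + 1 + 1 / 2 = (q:ℝ) + 3 / 2 by ring] at d2
  rw [show ((n:ℝ) - 1 + (2 * q + 1 : ℕ)) / 2 = (q:ℝ) + (n:ℝ) / 2 by push_cast; ring,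
    show (q:ℝ) + 3/2 + ((n:ℝ) - 2) / 2 = (q:ℝ) + (n:ℝ) / 2 + 1 / 2 by ring,
    show (q:ℝ) + (n:ℝ) / 2 - 1 / 2 = (q:ℝ) + ((n:ℝ) - 1) / 2 by ring]
  have e1 : (2:ℝ) ^ (1 - ((n:ℝ) - 2)) = (2 ^ ((n:ℝ) - 3))⁻¹ := by
    rw [← Real.rpow_neg (by norm_num)]; congr 1; ring
  have e2 : (2:ℝ) ^ (1 - 2 * ((q:ℝ) + 1)) = (2 ^ (2 * q + 1))⁻¹ := by
    rw [← Real.rpow_natCast, ← Real.rpow_neg (by norm_num)]; congr 1; push_cast; ring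
  rw [e1] at d1
  rw [e2] at d2
  have p1 : 0 < (2:ℝ) ^ ((n:ℝ) - 3) := by positivity
  have p2 := Gamma_pos_of_pos (show 0 < (n:ℝ) - 2 by linarith)
  have p3 := Gamma_pos_of_pos (show 0 < 2 * ((q:ℝ) + 1) by positivity)
  have p4 := Gamma_pos_of_pos (show 0 < (q:ℝ) + 1 by positivity)
  have p5 := Gamma_pos_of_pos (show 0 < ((n:ℝ) - 1) / 2 by linarith)
  have p6 := Gamma_pos_of_pos (show 0 < (q:ℝ) + ((n:ℝ) - 1) / 2 by
    have : (0:ℝ) ≤ q := by positivity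
    linarith)
  have p7 := Gamma_pos_of_pos (show 0 < (q:ℝ) + (n:ℝ) / 2 + 1 / 2 by positivity)
  have ps : √π * √π = π := Real.mul_self_sqrt pi_pos.le
  have psp : 0 < √π := Real.sqrt_pos.2 pi_pos
  generalize Gamma ((n:ℝ) - 2) = g1 at *
  generalize Gamma (2 * ((q:ℝ) + 1)) = g2 at *
  generalize Gamma ((q:ℝ) + 1) = g3 at *
  generalize Gamma (((n:ℝ) - 1) / 2) = g4 at *
  generalize Gamma ((q:ℝ) + ((n:ℝ) - 1) / 2) = g5 at *
  generalize Gamma ((q:ℝ) + (n:ℝ) / 2 + 1 / 2) = g6 at *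
  generalize Gamma (((n:ℝ) - 2) / 2) = g7 at *
  generalize Gamma ((q:ℝ) + 3 / 2) = g8 at *
  generalize (2:ℝ) ^ ((n:ℝ) - 3) = t at *
  generalize √π = s at *
  rw [← ps, mul_pow]
  have q1 : g7 = g1 * t⁻¹ * s / g4 := by field_simp at d1 ⊢; linarith
  have q2 : g8 = g2 * (2 ^ (2 * q + 1))⁻¹ * s / g3 := by field_simp at d2 ⊢; linarith
  rw [q1, q2]
  field_simp
  ring

/-- Series expression for the mean of the sample correlation coefficient in terms of `κ`. -/
theorem mean_eq_kappa_series {Ω : Type*} [MeasurableSpace Ω] (P : Measure Ω)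
    [IsProbabilityMeasure P] (n : ℕ) (hn : 3 ≤ n) (ρ : ℝ) (hρ : ρ ∈ Set.Ioo (-1 : ℝ) 1)
    (R : Ω → ℝ) (hR : Measurable R)
    (hlaw : Measure.map R P = volume.withDensity fun r => ENNReal.ofReal (fisherDensity n ρ r)) :
    ∫ ω, R ω ∂P =
      ρ * (1 - ρ ^ 2) ^ (((n : ℝ) - 1) / 2) *
        ∑' q : ℕ, Gamma ((q : ℝ) + ((n : ℝ) - 1) / 2) /
            (Gamma ((q : ℝ) + 1) * Gamma (((n : ℝ) - 1) / 2)) *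
          kappa ((q : ℝ) + (n : ℝ) / 2) * ρ ^ (2 * q) := by
  have e1 : ∫ ω, R ω ∂P = ∫ r, (∑' k, auxT n ρ k r * r) := by
    have := integral_map (μ := P) hR.aemeasurable (f := fun x : ℝ => x)
      measurable_id.aestronglyMeasurable
    rw [← this, hlaw, integral_withDensity_eq_integral_toReal_smul
      (fisher_meas n hn ρ hρ).ennreal_ofReal (by simp)]
    congr 1
    ext r
    rw [ENNReal.toReal_ofReal (fisher_nonneg n hn ρ hρ r), smul_eq_mul,
      ((auxT_hasSum n hn ρ hρ r).mul_right r).tsum_eq]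
  have hsum : Summable fun k => ∫ r, ‖auxT n ρ k r * r‖ := by
    have hs : Summable fun k => auxCoef n k * |2 * ρ| ^ k := by
      obtain ⟨p, rfl⟩ := Nat.exists_eq_add_of_le' (show 2 ≤ n by omega)
      refine auxCoef_summable p ?_
      have := abs_lt.2 hρ
      rw [abs_mul, abs_two]; linarith
    refine Summable.of_nonneg_of_le (fun k => integral_nonneg fun r => norm_nonneg _)
      (fun k => ?_) ((hs.mul_left (auxC n ρ)).mul_right (∫ r, auxW n r))
    rw [← integral_const_mul]
    exact integral_mono (auxT_int n hn ρ hρ k).norm ((auxW_int n hn).const_mul _)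
      (auxT_bound n hn ρ hρ k)
  have hS := hasSum_integral_of_summable_integral_norm (auxT_int n hn ρ hρ) hsum
  rw [e1, ← hS.tsum_eq, ← tsum_mul_left]
  have hinj : Function.Injective (fun q : ℕ => 2 * q + 1) := fun a b h => by
    simp only at h; omega
  rw [← hinj.tsum_eq]
  · exact tsum_congr fun q => auxT_integral_odd n hn ρ q
  · intro k hk
    rcases Nat.even_or_odd' k with ⟨q, rfl | rfl⟩
    · exact absurd (auxT_integral_even n ρ q) hk
    · exact ⟨q, rfl⟩
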